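/- Let T and T' be ℝ-trees and f : T → T' a continuous map. The following are equivalent: (1) f preserves alignment, i.e. x ∈ [y,z] implies f(x) ∈ [f(y), f(z)]; (2) the preimage under f of every convex subset of T' is convex; (3) for every x' ∈ T', the fiber f⁻¹(x') is connected. -/

import Mathlib

/-!
Formalization of definitions from V. Guirardel,
"Core and intersection number for group actions on trees".
-/

open Set Metric Filter Function Topology
open scoped ENNReal Pointwise

noncomputable section

namespace Guirardel

/-- The metric segment `[x,y]`: the set of points lying metrically between `x` and `y`.
In an `ℝ`-tree this is the image of the geodesic from `x` to `y`. -/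
def seg {T : Type*} [MetricSpace T] (x y : T) : Set T :=
  {p : T | dist x p + dist p y = dist x y}

/-- The open segment `]x,y[`. -/
def openSeg {T : Type*} [MetricSpace T] (x y : T) : Set T :=
  seg x y \ {x, y}

/-- A subset of an `ℝ`-tree is convex (i.e. a subtree when nonempty) if it contains the
segment between any two of its points. -/
def TreeConvex {T : Type*} [MetricSpace T] (S : Set T) : Prop :=
  ∀ x ∈ S, ∀ y ∈ S, seg x y ⊆ S

/-- An `ℝ`-tree: any two points are joined by a geodesic, and any two injective paths
with the same endpoints have the same image (uniqueness of arcs). -/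
structure IsRTree (T : Type*) [MetricSpace T] : Prop where
  exists_geod : ∀ x y : T, ∃ f : ℝ → T, f 0 = x ∧ f (dist x y) = y ∧
    ∀ s ∈ Icc (0 : ℝ) (dist x y), ∀ t ∈ Icc (0 : ℝ) (dist x y),
      dist (f s) (f t) = |s - t|
  arc_unique : ∀ (x y : T) (γ₁ γ₂ : Path x y),
    Function.Injective γ₁ → Function.Injective γ₂ →
      Set.range γ₁ = Set.range γ₂

/-- A direction based at `x`: a connected component of the complement of `x`. -/
def IsDirectionAt {T : Type*} [MetricSpace T] (δ : Set T) (x : T) : Prop :=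
  ∃ y : T, y ≠ x ∧ δ = connectedComponentIn {x}ᶜ y

/-- A direction in a tree. -/
def IsDirection {T : Type*} [MetricSpace T] (δ : Set T) : Prop :=
  ∃ x : T, IsDirectionAt δ x

/-- A branch point: a point with at least three directions. -/
def IsBranchPoint {T : Type*} [MetricSpace T] (x : T) : Prop :=
  ∃ δ₁ δ₂ δ₃ : Set T, IsDirectionAt δ₁ x ∧ IsDirectionAt δ₂ x ∧ IsDirectionAt δ₃ x ∧
    δ₁ ≠ δ₂ ∧ δ₁ ≠ δ₃ ∧ δ₂ ≠ δ₃

/-- A quadrant in `T₁ × T₂`: a product of two directions. -/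
def IsQuadrant {T₁ T₂ : Type*} [MetricSpace T₁] [MetricSpace T₂]
    (Q : Set (T₁ × T₂)) : Prop :=
  ∃ (δ₁ : Set T₁) (δ₂ : Set T₂), IsDirection δ₁ ∧ IsDirection δ₂ ∧ Q = δ₁ ×ˢ δ₂

/-- A quadrant is heavy if (for every choice of base point, which does not matter) there
is a sequence of orbit points inside it whose two coordinates go to infinity. -/
def Heavy (G : Type*) {T₁ T₂ : Type*} [Group G] [MetricSpace T₁] [MetricSpace T₂]
    [MulAction G T₁] [MulAction G T₂] (Q : Set (T₁ × T₂)) : Prop :=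
  ∀ p : T₁ × T₂, ∃ γ : ℕ → G,
    (∀ k, ((γ k • p.1 : T₁), (γ k • p.2 : T₂)) ∈ Q) ∧
    Tendsto (fun k => dist (γ k • p.1) p.1) atTop atTop ∧
    Tendsto (fun k => dist (γ k • p.2) p.2) atTop atTop

/-- The core of `T₁ × T₂`: the complement of the union of all light (i.e. non-heavy)
quadrants; equivalently the set of points all of whose quadrants are heavy. -/
def Core (G T₁ T₂ : Type*) [Group G] [MetricSpace T₁] [MetricSpace T₂]
    [MulAction G T₁] [MulAction G T₂] : Set (T₁ × T₂) :=
  {z : T₁ × T₂ | ∀ Q : Set (T₁ × T₂), IsQuadrant Q → z ∈ Q → Heavy G Q}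

/-- A subset of `T₁ × T₂` has convex fibers if its horizontal and vertical fibers
are convex. -/
def ConvexFibers {T₁ T₂ : Type*} [MetricSpace T₁] [MetricSpace T₂]
    (E : Set (T₁ × T₂)) : Prop :=
  (∀ x₁ : T₁, TreeConvex {y₂ : T₂ | (x₁, y₂) ∈ E}) ∧
  (∀ x₂ : T₂, TreeConvex {y₁ : T₁ | (y₁, x₂) ∈ E})

/-- The action of `G` on `T` is by isometries. -/
def IsometricAction (G T : Type*) [MetricSpace T] [SMul G T] : Prop :=
  ∀ (g : G) (x y : T), dist (g • x) (g • y) = dist x y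

/-- `g` is elliptic: it fixes a point of `T`. -/
def Elliptic {G : Type*} (T : Type*) [SMul G T] (g : G) : Prop :=
  ∃ x : T, g • x = x

/-- `g` is hyperbolic: it fixes no point of `T`. -/
def Hyperbolic {G : Type*} (T : Type*) [SMul G T] (g : G) : Prop :=
  ∀ x : T, g • x ≠ x

/-- Translation length of `g` on `T`. -/
def translationLength {G : Type*} (T : Type*) [MetricSpace T] [SMul G T] (g : G) : ℝ :=
  ⨅ x : T, dist x (g • x)

/-- The axis (characteristic set) of `g`: points minimizing displacement. -/
def axisSet {G : Type*} (T : Type*) [MetricSpace T] [SMul G T] (g : G) : Set T :=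
  {x : T | ∀ y : T, dist x (g • x) ≤ dist y (g • y)}

/-- The action is non-trivial: some element is hyperbolic. -/
def NontrivialAction (G T : Type*) [SMul G T] : Prop :=
  ∃ g : G, ∀ x : T, g • x ≠ x

/-- The action is free: only the identity fixes a point. -/
def FreeAction (G T : Type*) [Group G] [MulAction G T] : Prop :=
  ∀ g : G, g ≠ 1 → ∀ x : T, g • x ≠ x

/-- The action is minimal: no proper nonempty invariant subtree. -/
def MinimalAction (G T : Type*) [MetricSpace T] [SMul G T] : Prop :=
  ∀ S : Set T, S.Nonempty → TreeConvex S → (∀ g : G, ∀ x ∈ S, g • x ∈ S) → S = univ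

/-- The minimal subtree for the subset `H` of `G`: the intersection of all nonempty
invariant subtrees. -/
def minSubtreeOf {G : Type*} (H : Set G) (T : Type*) [MetricSpace T] [SMul G T] : Set T :=
  ⋂₀ {S : Set T | S.Nonempty ∧ TreeConvex S ∧ ∀ g ∈ H, ∀ x ∈ S, g • x ∈ S}

/-- The minimal subtree of the `G`-action. -/
def minSubtree (G T : Type*) [MetricSpace T] [SMul G T] : Set T :=
  minSubtreeOf (univ : Set G) T

/-- A line in `T`: the image of an isometric embedding of `ℝ`. -/
def IsLine {T : Type*} [MetricSpace T] (L : Set T) : Prop :=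
  ∃ f : ℝ → T, (∀ s t : ℝ, dist (f s) (f t) = |s - t|) ∧ L = range f

/-- A ray in `T`: the image of an isometric embedding of `[0,∞)`. -/
def IsRay {T : Type*} [MetricSpace T] (R : Set T) : Prop :=
  ∃ f : ℝ → T, (∀ s ∈ Ici (0 : ℝ), ∀ t ∈ Ici (0 : ℝ), dist (f s) (f t) = |s - t|) ∧
    R = f '' Ici 0

/-- Two rays (or subsets) define the same end when they are at finite Hausdorff distance. -/
def SameEnd {T : Type*} [MetricSpace T] (R R' : Set T) : Prop :=
  EMetric.hausdorffEdist R R' ≠ ⊤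

/-- The action of `G` fixes an end of `T`. -/
def GFixedEnd (G T : Type*) [MetricSpace T] [SMul G T] : Prop :=
  ∃ R : Set T, IsRay R ∧ ∀ g : G, SameEnd ((fun x => g • x) '' R) R

/-- The action of `G` has an invariant line. -/
def GInvariantLine (G T : Type*) [MetricSpace T] [SMul G T] : Prop :=
  ∃ L : Set T, IsLine L ∧ ∀ g : G, (fun x => g • x) '' L = L

/-- The action is irreducible: no invariant line and no fixed end. -/
def IrreducibleAction (G T : Type*) [MetricSpace T] [SMul G T] : Prop :=
  ¬ GInvariantLine G T ∧ ¬ GFixedEnd G T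

/-- The action is dihedral: there is an invariant line on which some element acts as a
reflection (i.e. with non-constant displacement along the line). -/
def DihedralAction (G T : Type*) [MetricSpace T] [SMul G T] : Prop :=
  ∃ L : Set T, IsLine L ∧ (∀ g : G, (fun x => g • x) '' L = L) ∧
    ∃ g : G, ∃ x ∈ L, ∃ y ∈ L, dist x (g • x) ≠ dist y (g • y)

/-- `A` is a positive semi-axis of `g`: a ray contained in the axis of `g` and mapped
into itself by `g`. -/
def PosSemiAxis {G : Type*} (T : Type*) [MetricSpace T] [SMul G T] (g : G) (A : Set T) :
    Prop :=
  IsRay A ∧ A ⊆ axisSet T g ∧ (fun x => g • x) '' A ⊆ A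

/-- `g` translates towards the end determined by the ray `R`:
`g` is hyperbolic and has a positive semi-axis defining the same end as `R`. -/
def TranslatesToward {G : Type*} (T : Type*) [MetricSpace T] [SMul G T] (g : G)
    (R : Set T) : Prop :=
  Hyperbolic T g ∧ ∃ A : Set T, PosSemiAxis T g A ∧ SameEnd A R

/-- The end `ω_T(g)` of the hyperbolic element `g` lies in the set of ends of `δ`:
some positive semi-axis of `g` is contained in `δ`. -/
def EndInSubtree {G : Type*} (T : Type*) [MetricSpace T] [SMul G T] (g : G)
    (δ : Set T) : Prop :=
  ∃ A : Set T, PosSemiAxis T g A ∧ A ⊆ δ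

/-- A map between `ℝ`-trees preserves alignment if the image of a point between `y`
and `z` lies between the images of `y` and `z`. -/
def AlignPreserving {T T' : Type*} [MetricSpace T] [MetricSpace T'] (f : T → T') : Prop :=
  ∀ x y z : T, x ∈ seg y z → f x ∈ seg (f y) (f z)

/-- `f : T → T'` witnesses that `T` is a refinement of `T'`: it is an equivariant
continuous surjection preserving alignment. -/
def IsRefinementMap (G : Type*) {T T' : Type*} [Group G] [MetricSpace T] [MetricSpace T']
    [MulAction G T] [MulAction G T'] (f : T → T') : Prop :=
  Continuous f ∧ Surjective f ∧ AlignPreserving f ∧ ∀ (g : G) (x : T), f (g • x) = g • f x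

/-- The length functions of the two actions are homothetic. -/
def HomotheticLengths (G T₁ T₂ : Type*) [MetricSpace T₁] [MetricSpace T₂] [SMul G T₁]
    [SMul G T₂] : Prop :=
  ∃ c : ℝ, 0 < c ∧ ∀ g : G, translationLength T₁ g = c * translationLength T₂ g

/-- A bundled `ℝ`-tree with an isometric action of `G`. -/
structure GTree (G : Type*) [Group G] where
  carrier : Type
  [ms : MetricSpace carrier]
  [ma : MulAction G carrier]
  isom : ∀ (g : G) (x y : carrier), dist (g • x) (g • y) = dist x y
  tree : IsRTree carrier

attribute [instance] GTree.ms GTree.ma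

/-- A simplicial structure on an `ℝ`-tree: a vertex set containing all branch points,
meeting every segment in a finite set, and discrete. -/
def IsSimplicialStructure {T : Type*} [MetricSpace T] (V : Set T) : Prop :=
  (∀ x : T, IsBranchPoint x → x ∈ V) ∧
  (∀ x y : T, (seg x y ∩ V).Finite) ∧
  (∀ v ∈ V, ∃ ε > 0, ∀ w ∈ V, dist v w < ε → w = v)

/-- Two vertices of a simplicial tree are adjacent (span an edge). -/
def Adjacent {T : Type*} [MetricSpace T] (V : Set T) (v w : T) : Prop :=
  v ∈ V ∧ w ∈ V ∧ v ≠ w ∧ seg v w ∩ V = {v, w}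

/-- A bundled simplicial `G`-tree. -/
structure SimplicialGTree (G : Type*) [Group G] extends GTree G where
  V : Set carrier
  simp : IsSimplicialStructure V
  inv : ∀ g : G, (fun x => g • x) '' V = V

/-- `T₁` and `T₂` are refinements of a common non-trivial simplicial action of `G`. -/
def RefineCommonSimplicial (G T₁ T₂ : Type*) [Group G] [MetricSpace T₁] [MetricSpace T₂]
    [MulAction G T₁] [MulAction G T₂] : Prop :=
  ∃ T' : SimplicialGTree G, NontrivialAction G T'.carrier ∧
    (∃ f₁ : T₁ → T'.carrier, IsRefinementMap G f₁) ∧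
    (∃ f₂ : T₂ → T'.carrier, IsRefinementMap G f₂)

/-- Two directions face each other: their union is the whole tree. -/
def FacingDirections {T : Type*} [MetricSpace T] (δ δ' : Set T) : Prop :=
  δ ∪ δ' = univ

/-- There is a twice-light rectangle with (opposite) base corners `x` and `x'`:
two light quadrants based at `x` and `x'` facing each other. -/
def IsTwiceLightRect (G : Type*) {T₁ T₂ : Type*} [Group G] [MetricSpace T₁]
    [MetricSpace T₂] [MulAction G T₁] [MulAction G T₂] (x x' : T₁ × T₂) : Prop :=
  ∃ (δ₁ : Set T₁) (δ₂ : Set T₂) (δ₁' : Set T₁) (δ₂' : Set T₂),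
    IsDirectionAt δ₁ x.1 ∧ IsDirectionAt δ₂ x.2 ∧
    IsDirectionAt δ₁' x'.1 ∧ IsDirectionAt δ₂' x'.2 ∧
    x.1 ≠ x'.1 ∧ x.2 ≠ x'.2 ∧
    FacingDirections δ₁ δ₁' ∧ FacingDirections δ₂ δ₂' ∧
    ¬ Heavy G (δ₁ ×ˢ δ₂) ∧ ¬ Heavy G (δ₁' ×ˢ δ₂')

/-- The open rectangle with opposite corners `x, x'`. -/
def openRect {T₁ T₂ : Type*} [MetricSpace T₁] [MetricSpace T₂] (x x' : T₁ × T₂) :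
    Set (T₁ × T₂) :=
  openSeg x.1 x'.1 ×ˢ openSeg x.2 x'.2

/-- A maximal twice-light rectangle. -/
def IsMaxTwiceLightRect (G : Type*) {T₁ T₂ : Type*} [Group G] [MetricSpace T₁]
    [MetricSpace T₂] [MulAction G T₁] [MulAction G T₂] (x x' : T₁ × T₂) : Prop :=
  IsTwiceLightRect G x x' ∧ ∀ y y' : T₁ × T₂, IsTwiceLightRect G y y' →
    openRect x x' ⊆ openRect y y' → openRect x x' = openRect y y'

/-- The straight diagonal of a rectangle joining the two opposite corners `p` and `q`. -/
def mainDiag {T₁ T₂ : Type*} [MetricSpace T₁] [MetricSpace T₂] (p q : T₁ × T₂) :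
    Set (T₁ × T₂) :=
  {z : T₁ × T₂ | z.1 ∈ seg p.1 q.1 ∧ z.2 ∈ seg p.2 q.2 ∧
    dist p.1 z.1 * dist p.2 q.2 = dist p.2 z.2 * dist p.1 q.1}

/-- The augmented core: the union of the core and of the main diagonals of the maximal
twice-light rectangles (the diagonals joining the two opposite corners lying in the core). -/
def AugCore (G T₁ T₂ : Type*) [Group G] [MetricSpace T₁] [MetricSpace T₂]
    [MulAction G T₁] [MulAction G T₂] : Set (T₁ × T₂) :=
  Core G T₁ T₂ ∪
    {z : T₁ × T₂ | ∃ x x' p q : T₁ × T₂, IsMaxTwiceLightRect G x x' ∧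
      p ∈ Core G T₁ T₂ ∧ q ∈ Core G T₁ T₂ ∧
      ({p.1, q.1} : Set T₁) = {x.1, x'.1} ∧ ({p.2, q.2} : Set T₂) = {x.2, x'.2} ∧
      p.1 ≠ q.1 ∧ p.2 ≠ q.2 ∧ z ∈ mainDiag p q}

/-- There exists an equivariant (strong) deformation retraction of `T₁ × T₂` onto `C`. -/
def EquivDeformRetract (G : Type*) {T₁ T₂ : Type*} [Group G] [MetricSpace T₁]
    [MetricSpace T₂] [MulAction G T₁] [MulAction G T₂] (C : Set (T₁ × T₂)) : Prop :=
  ∃ H : ℝ → T₁ × T₂ → T₁ × T₂,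
    Continuous (fun p : ℝ × (T₁ × T₂) => H p.1 p.2) ∧
    (∀ z : T₁ × T₂, H 0 z = z) ∧
    (∀ z : T₁ × T₂, H 1 z ∈ C) ∧
    (∀ t : ℝ, ∀ z ∈ C, H t z = z) ∧
    (∀ (t : ℝ) (g : G) (z : T₁ × T₂), H t (g • z) = g • H t z)

/-- The `ℓ²` product distance on `T₁ × T₂`. -/
def dist2 {T₁ T₂ : Type*} [MetricSpace T₁] [MetricSpace T₂] (p q : T₁ × T₂) : ℝ :=
  Real.sqrt (dist p.1 q.1 ^ 2 + dist p.2 q.2 ^ 2)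

/-- The length of a path `c : [0,1] → T₁ × T₂`, measured with the `ℓ²` product metric. -/
def pathLen2 {T₁ T₂ : Type*} [MetricSpace T₁] [MetricSpace T₂] (c : ℝ → T₁ × T₂) :
    ℝ≥0∞ :=
  ⨆ (n : ℕ) (u : Fin (n + 1) → ℝ) (_ : Monotone u) (_ : ∀ i, u i ∈ Icc (0 : ℝ) 1),
    ∑ i : Fin n, ENNReal.ofReal (dist2 (c (u i.castSucc)) (c (u i.succ)))

/-- The path metric induced on a subset `C ⊆ T₁ × T₂` by the `ℓ²` product metric. -/
def pathDistOn {T₁ T₂ : Type*} [MetricSpace T₁] [MetricSpace T₂] (C : Set (T₁ × T₂))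
    (x y : C) : ℝ :=
  (⨅ (c : ℝ → T₁ × T₂) (_ : ContinuousOn c (Icc (0 : ℝ) 1))
      (_ : MapsTo c (Icc (0 : ℝ) 1) C) (_ : c 0 = (x : T₁ × T₂))
      (_ : c 1 = (y : T₁ × T₂)), pathLen2 c).toReal

/-- A distance function makes a set a CAT(0) space: it is a metric, geodesic, and the
CN-inequality of Bruhat–Tits holds (comparison triangles are at least as thick). -/
structure IsCAT0Dist {X : Type*} (d : X → X → ℝ) : Prop where
  refl : ∀ x, d x x = 0
  symm : ∀ x y, d x y = d y x
  triangle : ∀ x y z, d x z ≤ d x y + d y z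
  eq_of_dist_eq_zero : ∀ x y, d x y = 0 → x = y
  geodesic : ∀ x y, ∃ f : ℝ → X, f 0 = x ∧ f (d x y) = y ∧
    ∀ s ∈ Icc (0 : ℝ) (d x y), ∀ t ∈ Icc (0 : ℝ) (d x y), d (f s) (f t) = |s - t|
  cn : ∀ x y z m, d y m = d y z / 2 → d m z = d y z / 2 →
    d x m ^ 2 ≤ (d x y ^ 2 + d x z ^ 2) / 2 - d y z ^ 2 / 4

/-- A 2-cell of the core of a product of two simplicial trees: a rectangle which is a
product of two edges and is contained in the core. -/
def IsCoreCell (G : Type*) {T₁ T₂ : Type*} [Group G] [MetricSpace T₁] [MetricSpace T₂]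
    [MulAction G T₁] [MulAction G T₂] (V₁ : Set T₁) (V₂ : Set T₂)
    (R : Set (T₁ × T₂)) : Prop :=
  ∃ v₁ w₁ v₂ w₂, Adjacent V₁ v₁ w₁ ∧ Adjacent V₂ v₂ w₂ ∧
    R = seg v₁ w₁ ×ˢ seg v₂ w₂ ∧ R ⊆ Core G T₁ T₂

theorem left_mem_seg {T : Type*} [MetricSpace T] (x y : T) : x ∈ seg x y := by
  simp [seg]

theorem right_mem_seg {T : Type*} [MetricSpace T] (x y : T) : y ∈ seg x y := by
  simp [seg]

theorem seg_comm {T : Type*} [MetricSpace T] (x y : T) : seg x y = seg y x := by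
  ext p
  simp only [seg, mem_ofPred_eq, dist_comm x, dist_comm p y, add_comm (dist p x)]

theorem seg_self {T : Type*} [MetricSpace T] (x : T) : seg x x = {x} := by
  ext p
  simp [seg, dist_comm p x, eq_comm]

theorem treeConvex_singleton {T : Type*} [MetricSpace T] (x : T) :
    TreeConvex ({x} : Set T) := by
  rintro a rfl b rfl
  exact (seg_self _).subset

theorem seg_subset_seg_left {T : Type*} [MetricSpace T] {x y m : T} (hm : m ∈ seg x y) :
    seg x m ⊆ seg x y := by
  intro p hp
  simp only [seg, mem_ofPred_eq] at *
  linarith [dist_triangle x p y, dist_triangle p m y]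

theorem seg_subset_seg_right {T : Type*} [MetricSpace T] {x y m : T} (hm : m ∈ seg x y) :
    seg m y ⊆ seg x y := by
  rw [seg_comm m y, seg_comm x y]
  exact seg_subset_seg_left (seg_comm x y ▸ hm)

/-- If `x` lies in `[y,z]`, it lies between any points of `[y,x]` and `[x,z]`. -/
theorem mem_seg_of_mem_seg {T : Type*} [MetricSpace T] {x y z a b : T} (hx : x ∈ seg y z)
    (ha : a ∈ seg y x) (hb : b ∈ seg x z) : x ∈ seg a b := by
  simp only [seg, mem_ofPred_eq] at *
  linarith [dist_triangle y a z, dist_triangle a b z, dist_triangle a x b]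

theorem seg_inter_seg_subset {T : Type*} [MetricSpace T] {x p z : T} (hp : p ∈ seg x z) :
    seg x p ∩ seg p z ⊆ {p} := by
  rintro q ⟨h₁, h₂⟩
  have h := mem_seg_of_mem_seg hp h₁ h₂
  rw [seg_self] at h
  exact h.symm

/-- A path of constant speed `dist x y` from `x` to `y`. -/
def ConstSpeed {T : Type*} [MetricSpace T] {x y : T} (γ : Path x y) : Prop :=
  ∀ s t, dist (γ s) (γ t) = |(s : ℝ) - t| * dist x y

theorem ConstSpeed.injective {T : Type*} [MetricSpace T] {x y : T} {γ : Path x y}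
    (hγ : ConstSpeed γ) (hxy : x ≠ y) : Injective γ := by
  intro s t h
  have h' := hγ s t
  rw [h, dist_self, eq_comm, mul_eq_zero, abs_eq_zero, sub_eq_zero] at h'
  exact Subtype.ext (h'.resolve_right (dist_ne_zero.2 hxy))

theorem ConstSpeed.mem_seg {T : Type*} [MetricSpace T] {x y : T} {γ : Path x y}
    (hγ : ConstSpeed γ) {r s t : unitInterval} (hrs : r ≤ s) (hst : s ≤ t) :
    γ s ∈ seg (γ r) (γ t) := by
  have h₁ : (r : ℝ) ≤ s := hrs
  have h₂ : (s : ℝ) ≤ t := hst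
  simp only [seg, mem_ofPred_eq, hγ r s, hγ s t, hγ r t]
  rw [abs_of_nonpos (by linarith), abs_of_nonpos (by linarith), abs_of_nonpos (by linarith)]
  ring

theorem ConstSpeed.range_subset_seg {T : Type*} [MetricSpace T] {x y : T} {γ : Path x y}
    (hγ : ConstSpeed γ) : range γ ⊆ seg x y := by
  rintro _ ⟨t, rfl⟩
  simpa using hγ.mem_seg (r := 0) (t := 1) unitInterval.nonneg' unitInterval.le_one'

theorem injective_path_trans {X : Type*} [TopologicalSpace X] {x y z : X}
    {γ₁ : Path x y} {γ₂ : Path y z} (h₁ : Injective γ₁) (h₂ : Injective γ₂)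
    (h : range γ₁ ∩ range γ₂ ⊆ {y}) : Injective (γ₁.trans γ₂) := by
  have key : ∀ s t : unitInterval, (s : ℝ) ≤ 1 / 2 → ¬ (t : ℝ) ≤ 1 / 2 →
      γ₁.trans γ₂ s ≠ γ₁.trans γ₂ t := by
    intro s t hs ht hst
    rw [Path.trans_apply, Path.trans_apply, dif_pos hs, dif_neg ht] at hst
    have hy : γ₂ ⟨2 * (t : ℝ) - 1, unitInterval.two_mul_sub_one_mem_iff.2
        ⟨(not_le.1 ht).le, t.2.2⟩⟩ = γ₂ 0 := by
      rw [γ₂.source]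
      exact h ⟨⟨_, hst⟩, ⟨_, rfl⟩⟩
    have := congrArg Subtype.val (h₂ hy)
    simp only [Set.Icc.coe_zero] at this
    linarith
  intro s t hst
  by_cases hs : (s : ℝ) ≤ 1 / 2 <;> by_cases ht : (t : ℝ) ≤ 1 / 2
  · rw [Path.trans_apply, Path.trans_apply, dif_pos hs, dif_pos ht] at hst
    have := congrArg Subtype.val (h₁ hst)
    exact Subtype.ext (by simpa using this)
  · exact absurd hst (key s t hs ht)
  · exact absurd hst.symm (key t s ht hs)
  · rw [Path.trans_apply, Path.trans_apply, dif_neg hs, dif_neg ht] at hst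
    have := congrArg Subtype.val (h₂ hst)
    exact Subtype.ext (by simpa using this)

namespace IsRTree

variable {T : Type*} [MetricSpace T]

theorem exists_constSpeed (hT : IsRTree T) (x y : T) : ∃ γ : Path x y, ConstSpeed γ := by
  obtain ⟨g, h0, h1, hg⟩ := hT.exists_geod x y
  have hmem : ∀ t : unitInterval, (t : ℝ) * dist x y ∈ Icc 0 (dist x y) := fun t =>
    ⟨mul_nonneg t.2.1 dist_nonneg, mul_le_of_le_one_left dist_nonneg t.2.2⟩
  have hd : ∀ s t : unitInterval,
      dist (g (s * dist x y)) (g (t * dist x y)) = |(s : ℝ) - t| * dist x y := by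
    intro s t
    rw [hg _ (hmem s) _ (hmem t), ← sub_mul, abs_mul, abs_of_nonneg (dist_nonneg (x := x))]
  have hc : Continuous fun t : unitInterval => g (t * dist x y) := by
    refine (LipschitzWith.of_dist_le_mul (K := nndist x y) fun s t => ?_).continuous
    rw [hd, mul_comm, coe_nndist, Subtype.dist_eq, Real.dist_eq]
  exact ⟨⟨⟨fun t => g (t * dist x y), hc⟩, by simp [h0], by simp [h1]⟩, hd⟩

/-- If `[x,p]` and `[p,z]` only meet at `p`, then `p` lies on every arc from `x` to `z`. -/
theorem mem_range_of_seg_inter_subset (hT : IsRTree T) {x p z : T}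
    (h : seg x p ∩ seg p z ⊆ {p}) {γ : Path x z} (hγ : Injective γ) : p ∈ range γ := by
  rcases eq_or_ne x p with rfl | hxp
  · exact ⟨0, γ.source⟩
  rcases eq_or_ne p z with rfl | hpz
  · exact ⟨1, γ.target⟩
  obtain ⟨γ₁, h₁⟩ := hT.exists_constSpeed x p
  obtain ⟨γ₂, h₂⟩ := hT.exists_constSpeed p z
  have hinj := injective_path_trans (h₁.injective hxp) (h₂.injective hpz)
    ((inter_subset_inter h₁.range_subset_seg h₂.range_subset_seg).trans h)
  rw [hT.arc_unique x z γ _ hγ hinj, Path.trans_range]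
  exact Or.inl ⟨1, γ₁.target⟩

theorem range_eq_seg (hT : IsRTree T) {x y : T} {γ : Path x y} (hγ : ConstSpeed γ) :
    range γ = seg x y := by
  refine hγ.range_subset_seg.antisymm fun p hp => ?_
  rcases eq_or_ne x y with rfl | hxy
  · rw [seg_self] at hp
    exact ⟨0, γ.source.trans hp.symm⟩
  · exact hT.mem_range_of_seg_inter_subset (seg_inter_seg_subset hp) (hγ.injective hxy)

theorem isCompact_seg (hT : IsRTree T) (x y : T) : IsCompact (seg x y) := by
  obtain ⟨γ, hγ⟩ := hT.exists_constSpeed x y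
  exact hT.range_eq_seg hγ ▸ isCompact_range γ.continuous

theorem isPreconnected_seg (hT : IsRTree T) (x y : T) : IsPreconnected (seg x y) := by
  obtain ⟨γ, hγ⟩ := hT.exists_constSpeed x y
  exact hT.range_eq_seg hγ ▸ isPreconnected_range γ.continuous

theorem mem_seg_of_seg_inter_subset (hT : IsRTree T) {x p z : T}
    (h : seg x p ∩ seg p z ⊆ {p}) : p ∈ seg x z := by
  rcases eq_or_ne x z with rfl | hxz
  · have hx := h ⟨left_mem_seg x p, right_mem_seg p x⟩
    rw [mem_singleton_iff.1 hx, seg_self]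
    rfl
  · obtain ⟨γ, hγ⟩ := hT.exists_constSpeed x z
    exact hγ.range_subset_seg (hT.mem_range_of_seg_inter_subset h (hγ.injective hxz))

/-- Any three points of an `ℝ`-tree have a median. -/
theorem exists_median (hT : IsRTree T) (u v w : T) :
    ∃ p, p ∈ seg u v ∧ p ∈ seg u w ∧ p ∈ seg v w := by
  obtain ⟨p, hp, hmin⟩ := (hT.isCompact_seg v w).exists_isMinOn ⟨v, left_mem_seg v w⟩
    (f := dist u) (by fun_prop)
  have hproj : ∀ q ∈ seg u p, q ∈ seg v w → q = p := by
    intro q hq hq'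
    have h₁ : dist u p ≤ dist u q := hmin hq'
    have h₂ : dist u q + dist q p = dist u p := hq
    exact dist_le_zero.1 (by linarith)
  refine ⟨p, hT.mem_seg_of_seg_inter_subset ?_, hT.mem_seg_of_seg_inter_subset ?_, hp⟩
  · rintro q ⟨hq, hq'⟩
    exact hproj q hq (seg_subset_seg_left hp (seg_comm p v ▸ hq'))
  · rintro q ⟨hq, hq'⟩
    exact hproj q hq (seg_subset_seg_right hp hq')

/-- Two points of a segment are ordered along it. -/
theorem mem_seg_or_mem_seg (hT : IsRTree T) {x y p m : T} (hp : p ∈ seg x y)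
    (hm : m ∈ seg x y) : p ∈ seg x m ∨ p ∈ seg m y := by
  obtain ⟨γ, hγ⟩ := hT.exists_constSpeed x y
  rw [← hT.range_eq_seg hγ] at hp hm
  obtain ⟨s, rfl⟩ := hp
  obtain ⟨t, rfl⟩ := hm
  rcases le_total s t with hst | hst
  · left
    simpa using hγ.mem_seg (r := 0) unitInterval.nonneg' hst
  · right
    simpa using hγ.mem_seg (t := 1) hst unitInterval.le_one'

theorem mem_seg_of_dist_lt (hT : IsRTree T) {y p q r : T} (hd : dist q r < dist q p)
    (hp : p ∈ seg y r) : p ∈ seg y q := by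
  obtain ⟨m, hmq, hmr, hm⟩ := hT.exists_median y q r
  rcases hT.mem_seg_or_mem_seg hp hmr with h | h
  · exact seg_subset_seg_left hmq h
  · have h' : dist q p + dist p r = dist q r := seg_subset_seg_right hm h
    linarith [dist_nonneg (x := p) (y := r)]

theorem treeConvex_of_isPreconnected (hT : IsRTree T) {C : Set T} (hC : IsPreconnected C) :
    TreeConvex C := by
  intro y hy z hz p hp
  by_contra hpC
  have hne : ∀ q ∈ C, q ≠ p := fun q hq h => hpC (h ▸ hq)
  have hA : IsOpen {q | q ≠ p ∧ p ∉ seg y q} := by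
    refine Metric.isOpen_iff.2 fun q hq => ⟨dist q p, dist_pos.2 hq.1, fun r hr => ?_⟩
    rw [mem_ball'] at hr
    exact ⟨fun h => hr.ne (h ▸ rfl), fun h => hq.2 (hT.mem_seg_of_dist_lt hr h)⟩
  have hB : IsOpen {q | q ≠ p ∧ p ∈ seg y q} := by
    refine Metric.isOpen_iff.2 fun q hq =>
      ⟨dist q p / 2, half_pos (dist_pos.2 hq.1), fun r hr => ?_⟩
    rw [mem_ball] at hr
    have hlt : dist r q < dist r p := by
      linarith [dist_triangle q r p, dist_comm q r]
    exact ⟨dist_pos.1 (dist_nonneg.trans_lt hlt), hT.mem_seg_of_dist_lt hlt hq.2⟩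
  obtain ⟨q, -, hqA, hqB⟩ := hC _ _ hA hB
    (fun q hq => (em (p ∈ seg y q)).elim (fun h => Or.inr ⟨hne q hq, h⟩)
      fun h => Or.inl ⟨hne q hq, h⟩)
    ⟨y, hy, hne y hy, fun h => hne y hy (by rw [seg_self] at h; exact h.symm)⟩
    ⟨z, hz, hne z hz, hp⟩
  exact hqA.2 hqB.2

theorem isPreconnected_of_treeConvex (hT : IsRTree T) {C : Set T} (hC : TreeConvex C) :
    IsPreconnected C :=
  isPreconnected_of_forall_pair fun x hx y hy =>
    ⟨seg x y, hC x hx y hy, left_mem_seg x y, right_mem_seg x y, hT.isPreconnected_seg x y⟩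

end IsRTree

/-- Lemma 1.1: for a continuous map between `ℝ`-trees, preserving
alignment, having convex preimages of convex sets, and having connected fibers are
equivalent. -/
theorem alignPreserving_tfae
    {T T' : Type*} [MetricSpace T] [MetricSpace T']
    (hT : IsRTree T) (hT' : IsRTree T')
    (f : T → T') (hf : Continuous f) :
    List.TFAE [AlignPreserving f,
      ∀ S : Set T', TreeConvex S → TreeConvex (f ⁻¹' S),
      ∀ x' : T', IsPreconnected (f ⁻¹' {x'})] := by
  tfae_have 1 → 2 := fun h S hS y hy z hz x hx => hS _ hy _ hz (h x y z hx)
  tfae_have 2 → 3 := fun h x' =>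
    hT.isPreconnected_of_treeConvex (h _ (treeConvex_singleton x'))
  tfae_have 3 → 1 := by
    intro h x y z hx
    obtain ⟨p, hxy, hxz, hyz⟩ := hT'.exists_median (f x) (f y) (f z)
    have himage : ∀ u v : T, seg (f u) (f v) ⊆ f '' seg u v := fun u v =>
      hT'.treeConvex_of_isPreconnected
        ((hT.isPreconnected_seg u v).image f hf.continuousOn)
        _ (mem_image_of_mem f (left_mem_seg u v)) _ (mem_image_of_mem f (right_mem_seg u v))
    obtain ⟨a, ha, hfa⟩ := himage y x (seg_comm (f x) (f y) ▸ hxy)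
    obtain ⟨b, hb, hfb⟩ := himage x z hxz
    have hfx : f x = p := hT.treeConvex_of_isPreconnected (h p) a hfa b hfb
      (mem_seg_of_mem_seg hx ha hb)
    rwa [hfx]
  tfae_finish

end Guirardel
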